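/- Let S_1,…,S_K ⊆ ℂ be pairwise distinct finite nonempty constellation sets, let N₀ > 0, fix i ∈ {1,…,K}, and let (r_n)_{n≥1} be an i.i.d. sequence of ℂ-valued random variables with law P_{S_i,N₀}. Then lim_{N→∞} ℙ( there exists j ≠ i with Σ_{n=1}^{N} log f_{S_j,N₀}(r_n) ≥ Σ_{n=1}^{N} log f_{S_i,N₀}(r_n) ) = 0; that is, the probability of classification error of the maximum-likelihood classifier vanishes as the number of observations N → ∞. -/

import Mathlib

open Real MeasureTheory ProbabilityTheory Filter

/-- The equal-weight homoscedastic complex Gaussian mixture density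
`f_{S,N₀}(r) = (1/|S|) · Σ_{μ ∈ S} (1/(π N₀)) · exp(−|r − μ|²/N₀)`. -/
noncomputable def mixDensity (S : Finset ℂ) (N₀ : ℝ) (r : ℂ) : ℝ :=
  (S.card : ℝ)⁻¹ * ∑ μ ∈ S, (π * N₀)⁻¹ * Real.exp (-‖r - μ‖ ^ 2 / N₀)

/-- The probability measure `P_{S,N₀}` on `ℂ` with density `f_{S,N₀}` w.r.t. Lebesgue measure. -/
noncomputable def mixMeasure (S : Finset ℂ) (N₀ : ℝ) : Measure ℂ :=
  volume.withDensity fun r => ENNReal.ofReal (mixDensity S N₀ r)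

/-- Kullback–Leibler divergence `∫ log (dP/dQ) dP` of measures (`⊤` if `P` is not absolutely
continuous w.r.t. `Q` or the log-likelihood ratio is not integrable). -/
noncomputable def klDiv {α : Type*} [MeasurableSpace α] (P Q : Measure α) : EReal := by
  classical
  exact if P ≪ Q ∧ Integrable (llr P Q) P then ((∫ x, llr P Q x ∂P : ℝ) : EReal) else ⊤

lemma mixDensity_pos {S : Finset ℂ} (hS : S.Nonempty) {N₀ : ℝ} (hN : 0 < N₀) (r : ℂ) :
    0 < mixDensity S N₀ r := by
  unfold mixDensity
  have hc : (0 : ℝ) < S.card := by exact_mod_cast hS.card_pos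
  refine mul_pos (inv_pos.2 hc) (Finset.sum_pos (fun μ _ => ?_) hS)
  have := Real.pi_pos
  positivity

lemma mixDensity_continuous (S : Finset ℂ) (N₀ : ℝ) : Continuous (mixDensity S N₀) := by
  unfold mixDensity
  fun_prop

lemma gauss_int {N₀ : ℝ} (hN : 0 < N₀) (μ : ℂ) :
    ∫ r : ℂ, Real.exp (-‖r - μ‖ ^ 2 / N₀) = π * N₀ := by
  rw [integral_sub_right_eq_self (fun r : ℂ => Real.exp (-‖r‖ ^ 2 / N₀)) μ]
  have h := GaussianFourier.integral_rexp_neg_mul_sq_norm (V := ℂ) (b := N₀⁻¹) (by positivity)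
  rw [Complex.finrank_real_complex] at h
  norm_num at h
  rw [← h]
  congr 1
  ext r
  congr 1
  field_simp

lemma gauss_integrable {N₀ : ℝ} (hN : 0 < N₀) (μ : ℂ) :
    Integrable (fun r : ℂ => Real.exp (-‖r - μ‖ ^ 2 / N₀)) := by
  apply Integrable.of_integral_ne_zero
  rw [gauss_int hN]
  have := Real.pi_pos
  positivity

lemma mixDensity_integrable (S : Finset ℂ) {N₀ : ℝ} (hN : 0 < N₀) :
    Integrable (mixDensity S N₀) := by
  unfold mixDensity
  exact (integrable_finsetSum _ fun μ _ => (gauss_integrable hN μ).const_mul _).const_mul _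

lemma mixDensity_integral {S : Finset ℂ} (hS : S.Nonempty) {N₀ : ℝ} (hN : 0 < N₀) :
    ∫ r, mixDensity S N₀ r = 1 := by
  unfold mixDensity
  have hc : (S.card : ℝ) ≠ 0 := by exact_mod_cast hS.card_pos.ne'
  have := Real.pi_pos
  rw [integral_const_mul, integral_finsetSum _ fun μ _ => (gauss_integrable hN μ).const_mul _]
  simp_rw [integral_const_mul, gauss_int hN]
  rw [Finset.sum_const, nsmul_eq_mul]
  field_simp

lemma mixDensity_lintegral {S : Finset ℂ} (hS : S.Nonempty) {N₀ : ℝ} (hN : 0 < N₀) :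
    ∫⁻ r, ENNReal.ofReal (mixDensity S N₀ r) = 1 := by
  rw [← ofReal_integral_eq_lintegral_ofReal (mixDensity_integrable S hN)
    (ae_of_all _ fun r => (mixDensity_pos hS hN r).le), mixDensity_integral hS hN]
  simp

/-- The exponential character attached to a point. -/
noncomputable def expChar (N₀ : ℝ) (μ : ℂ) : Multiplicative ℂ →* ℝ where
  toFun r := Real.exp (2 * (r.toAdd.re * μ.re + r.toAdd.im * μ.im) / N₀)
  map_one' := by simp
  map_mul' a b := by
    rw [← Real.exp_add]
    congr 1
    simp
    ring

lemma expChar_injective {N₀ : ℝ} (hN : 0 < N₀) : Function.Injective (expChar N₀) := by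
  intro μ ν h
  have h1 := DFunLike.congr_fun h (Multiplicative.ofAdd (1 : ℂ))
  have h2 := DFunLike.congr_fun h (Multiplicative.ofAdd Complex.I)
  simp only [expChar, MonoidHom.coe_mk, OneHom.coe_mk, toAdd_ofAdd, Real.exp_eq_exp] at h1 h2
  simp at h1 h2
  field_simp at h1 h2
  exact Complex.ext h1 h2

lemma gauss_eq {N₀ : ℝ} (r μ : ℂ) :
    Real.exp (-‖r - μ‖ ^ 2 / N₀) = Real.exp (-‖r‖ ^ 2 / N₀) *
      (Real.exp (-‖μ‖ ^ 2 / N₀) * expChar N₀ μ (Multiplicative.ofAdd r)) := by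
  simp only [expChar, MonoidHom.coe_mk, OneHom.coe_mk, toAdd_ofAdd]
  rw [← Real.exp_add, ← Real.exp_add]
  congr 1
  simp only [← Complex.normSq_eq_norm_sq, Complex.normSq_apply, Complex.sub_re, Complex.sub_im]
  ring

lemma mixDensity_inj {S T : Finset ℂ} (hS : S.Nonempty) (hT : T.Nonempty) {N₀ : ℝ} (hN : 0 < N₀)
    (h : mixDensity S N₀ = mixDensity T N₀) : S = T := by
  classical
  have hS0 : (S.card : ℝ) ≠ 0 := by exact_mod_cast hS.card_pos.ne'
  have hT0 : (T.card : ℝ) ≠ 0 := by exact_mod_cast hT.card_pos.ne'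
  have li := (linearIndependent_monoidHom (Multiplicative ℂ) ℝ).comp _ (expChar_injective hN)
  rw [linearIndependent_iff'] at li
  let c : Finset ℂ → ℂ → ℝ := fun A μ =>
    if μ ∈ A then (A.card : ℝ)⁻¹ * Real.exp (-‖μ‖ ^ 2 / N₀) else 0
  have key : ∀ A : Finset ℂ, A ⊆ S ∪ T → ∀ r : ℂ,
      ∑ μ ∈ S ∪ T, c A μ * expChar N₀ μ (Multiplicative.ofAdd r) =
        (π * N₀) * Real.exp (‖r‖ ^ 2 / N₀) * mixDensity A N₀ r := by
    intro A hA r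
    rw [← Finset.sum_subset hA (fun μ _ hμ => by simp [c, hμ])]
    unfold mixDensity
    rw [Finset.mul_sum, Finset.mul_sum]
    refine Finset.sum_congr rfl fun μ hμ => ?_
    rw [gauss_eq]
    simp only [c, hμ, if_true]
    have e : Real.exp (‖r‖ ^ 2 / N₀) * Real.exp (-‖r‖ ^ 2 / N₀) = 1 := by
      rw [← Real.exp_add, neg_div]; simp
    have hp : π * N₀ * (π * N₀)⁻¹ = 1 := mul_inv_cancel₀ (mul_pos Real.pi_pos hN).ne'
    linear_combination (-(A.card : ℝ)⁻¹ * Real.exp (-‖μ‖ ^ 2 / N₀) *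
      expChar N₀ μ (Multiplicative.ofAdd r)) * (e * (π * N₀ * (π * N₀)⁻¹) + hp)
  have z := li (S ∪ T) (fun μ => c S μ - c T μ) (by
    ext r
    have k1 := key S Finset.subset_union_left r.toAdd
    have k2 := key T Finset.subset_union_right r.toAdd
    rw [h, ← k2] at k1
    simp only [Finset.sum_apply, Pi.smul_apply, Function.comp, smul_eq_mul, sub_mul,
      Finset.sum_sub_distrib, Pi.zero_apply]
    exact sub_eq_zero.2 k1)
  ext μ
  by_cases h1 : μ ∈ S <;> by_cases h2 : μ ∈ T <;> simp only [h1, h2]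
  · have := z μ (by simp [h1])
    simp [c, h1, h2, hS.ne_empty] at this
  · have := z μ (by simp [h2])
    simp [c, h1, h2, hT.ne_empty] at this

/-- square root of the likelihood ratio -/
noncomputable def sqrtLR (S T : Finset ℂ) (N₀ : ℝ) (z : ℂ) : ENNReal :=
  ENNReal.ofReal (Real.exp ((Real.log (mixDensity T N₀ z) - Real.log (mixDensity S N₀ z)) / 2))

lemma sqrtLR_measurable (S T : Finset ℂ) (N₀ : ℝ) : Measurable (sqrtLR S T N₀) := by
  unfold sqrtLR
  have h1 := (mixDensity_continuous S N₀).measurable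
  have h2 := (mixDensity_continuous T N₀).measurable
  fun_prop

lemma bhatt_lt_one {S T : Finset ℂ} (hS : S.Nonempty) (hT : T.Nonempty) {N₀ : ℝ} (hN : 0 < N₀)
    (hne : S ≠ T) : ∫⁻ z, sqrtLR S T N₀ z ∂(mixMeasure S N₀) < 1 := by
  have mS := (mixDensity_continuous S N₀).measurable
  have mT := (mixDensity_continuous T N₀).measurable
  unfold mixMeasure
  rw [lintegral_withDensity_eq_lintegral_mul _ (by fun_prop) (sqrtLR_measurable S T N₀)]
  have hhalf : ∫⁻ z, ENNReal.ofReal ((mixDensity S N₀ z + mixDensity T N₀ z) / 2) = 1 := by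
    have hint : Integrable (fun z => (mixDensity S N₀ z + mixDensity T N₀ z) / 2) :=
      ((mixDensity_integrable S hN).add (mixDensity_integrable T hN)).div_const 2
    have hnn : ∀ z, 0 ≤ (mixDensity S N₀ z + mixDensity T N₀ z) / 2 := fun z => by
      have := mixDensity_pos hS hN z
      have := mixDensity_pos hT hN z
      positivity
    rw [← ofReal_integral_eq_lintegral_ofReal hint (ae_of_all _ hnn), integral_div,
      integral_add (mixDensity_integrable S hN) (mixDensity_integrable T hN),
      mixDensity_integral hS hN, mixDensity_integral hT hN]
    norm_num
  have hpt : ∀ z, (fun z => ENNReal.ofReal (mixDensity S N₀ z) * sqrtLR S T N₀ z) z =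
      ENNReal.ofReal (Real.exp (Real.log (mixDensity S N₀ z) / 2) *
        Real.exp (Real.log (mixDensity T N₀ z) / 2)) := by
    intro z
    simp only [sqrtLR]
    rw [← ENNReal.ofReal_mul (mixDensity_pos hS hN z).le]
    congr 1
    conv_lhs => rw [← Real.exp_log (mixDensity_pos hS hN z)]
    rw [Real.log_exp, ← Real.exp_add, ← Real.exp_add]
    congr 1
    ring
  have hsq : ∀ {A : Finset ℂ}, A.Nonempty → ∀ z,
      Real.exp (Real.log (mixDensity A N₀ z) / 2) ^ 2 = mixDensity A N₀ z := by
    intro A hA z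
    rw [← Real.exp_nat_mul]
    push_cast
    rw [mul_div_cancel₀ _ (by norm_num), Real.exp_log (mixDensity_pos hA hN z)]
  have hle : ∀ z, ENNReal.ofReal (mixDensity S N₀ z) * sqrtLR S T N₀ z ≤
      ENNReal.ofReal ((mixDensity S N₀ z + mixDensity T N₀ z) / 2) := by
    intro z
    have := hpt z
    simp only at this
    rw [this]
    apply ENNReal.ofReal_le_ofReal
    rw [← hsq hS z, ← hsq hT z]
    simp only [hsq hS z, hsq hT z]
    nlinarith [sq_nonneg (Real.exp (Real.log (mixDensity S N₀ z) / 2) -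
      Real.exp (Real.log (mixDensity T N₀ z) / 2)), hsq hS z, hsq hT z]
  conv_rhs => rw [← hhalf]
  have hfin : ∫⁻ z, ((fun z => ENNReal.ofReal (mixDensity S N₀ z)) * sqrtLR S T N₀) z ≠ ⊤ :=
    ((lintegral_mono hle).trans_lt (by rw [hhalf]; simp)).ne
  refine lintegral_strict_mono_of_ae_le_of_frequently_ae_lt (by fun_prop) hfin (ae_of_all _ hle) ?_
  intro hcon
  apply hne
  apply mixDensity_inj hS hT hN
  rw [← Continuous.ae_eq_iff_eq volume (mixDensity_continuous S N₀) (mixDensity_continuous T N₀)]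
  filter_upwards [hcon] with z hz
  rw [not_not] at hz
  have h1 := hpt z
  simp only [Pi.mul_apply] at hz h1
  rw [h1] at hz
  have pS := mixDensity_pos hS hN z
  have pT := mixDensity_pos hT hN z
  rw [ENNReal.ofReal_eq_ofReal_iff (by positivity) (by positivity)] at hz
  have h0 : (Real.exp (Real.log (mixDensity S N₀ z) / 2) -
      Real.exp (Real.log (mixDensity T N₀ z) / 2)) ^ 2 = 0 := by
    linear_combination hsq hS z + hsq hT z - 2 * hz
  have h0 := sub_eq_zero.1 (pow_eq_zero_iff (two_ne_zero) |>.1 h0)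
  rw [← hsq hS z, h0, hsq hT z]

lemma pair_bound {Ω : Type*} [MeasurableSpace Ω] (P : Measure Ω)
    (S T : Finset ℂ) (N₀ : ℝ)
    (r : ℕ → Ω → ℂ) (hmeas : ∀ n, Measurable (r n)) (hindep : iIndepFun r P)
    (hlaw : ∀ n, Measure.map (r n) P = mixMeasure S N₀) (N : ℕ) :
    P {ω | ∑ n ∈ Finset.range N, Real.log (mixDensity S N₀ (r n ω)) ≤
          ∑ n ∈ Finset.range N, Real.log (mixDensity T N₀ (r n ω))} ≤
      (∫⁻ z, sqrtLR S T N₀ z ∂(mixMeasure S N₀)) ^ N := by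
  have hm := sqrtLR_measurable S T N₀
  have hX : ∀ n, Measurable (sqrtLR S T N₀ ∘ r n) := fun n => hm.comp (hmeas n)
  have h := lintegral_prod_eq_prod_lintegral_of_indepFun (Finset.range N)
    (fun n => sqrtLR S T N₀ ∘ r n) (hindep.comp (fun _ => sqrtLR S T N₀) (fun _ => hm)) hX
  have h2 : ∀ n, ∫⁻ ω, (sqrtLR S T N₀ ∘ r n) ω ∂P = ∫⁻ z, sqrtLR S T N₀ z ∂(mixMeasure S N₀) := by
    intro n
    rw [← hlaw n, lintegral_map hm (hmeas n)]
    rfl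
  simp only [h2, Finset.prod_const, Finset.card_range] at h
  rw [← h]
  refine meas_le_lintegral₀ (Finset.measurable_fun_prod _ fun n _ => hX n).aemeasurable ?_
  intro ω hω
  simp only [Set.mem_ofPred_eq] at hω
  simp only [Function.comp, sqrtLR]
  rw [← ENNReal.ofReal_prod_of_nonneg (fun n _ => (Real.exp_pos _).le), ← Real.exp_sum,
    ENNReal.one_le_ofReal, Real.one_le_exp_iff, ← Finset.sum_div, Finset.sum_sub_distrib]
  linarith

/-- **Theorem 1.** The probability of classification error of the ML classifier
vanishes as the number of observations tends to infinity. -/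
theorem ml_classifier_error_tendsto_zero {Ω : Type*} [MeasureSpace Ω]
    [IsProbabilityMeasure (ℙ : Measure Ω)]
    (K : ℕ) (S : Fin K → Finset ℂ) (hne : ∀ k, (S k).Nonempty)
    (hdist : Function.Injective S)
    (N₀ : ℝ) (hN₀ : 0 < N₀) (i : Fin K)
    (r : ℕ → Ω → ℂ) (hmeas : ∀ n, Measurable (r n))
    (hindep : iIndepFun r ℙ)
    (hlaw : ∀ n, Measure.map (r n) ℙ = mixMeasure (S i) N₀) :
    Tendsto
      (fun N : ℕ => (ℙ : Measure Ω) {ω | ∃ j ≠ i,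
        ∑ n ∈ Finset.range N, Real.log (mixDensity (S i) N₀ (r n ω)) ≤
          ∑ n ∈ Finset.range N, Real.log (mixDensity (S j) N₀ (r n ω))})
      atTop (nhds 0) := by
  have hb : ∀ N : ℕ, (ℙ : Measure Ω) {ω | ∃ j ≠ i,
        ∑ n ∈ Finset.range N, Real.log (mixDensity (S i) N₀ (r n ω)) ≤
          ∑ n ∈ Finset.range N, Real.log (mixDensity (S j) N₀ (r n ω))} ≤
      ∑ j ∈ Finset.univ.erase i,
        (∫⁻ z, sqrtLR (S i) (S j) N₀ z ∂(mixMeasure (S i) N₀)) ^ N := by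
    intro N
    refine le_trans (measure_mono ?_) ((measure_biUnion_finset_le (Finset.univ.erase i)
      (fun j => {ω | ∑ n ∈ Finset.range N, Real.log (mixDensity (S i) N₀ (r n ω)) ≤
          ∑ n ∈ Finset.range N, Real.log (mixDensity (S j) N₀ (r n ω))})).trans
      (Finset.sum_le_sum fun j _ => pair_bound ℙ (S i) (S j) N₀ r hmeas hindep hlaw N))
    rintro ω ⟨j, hj, h⟩
    simp only [Set.mem_iUnion]
    exact ⟨j, by simp [hj], h⟩
  refine tendsto_of_tendsto_of_tendsto_of_le_of_le tendsto_const_nhds ?_ (fun _ => bot_le) hb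
  rw [← Finset.sum_const_zero (s := Finset.univ.erase i)]
  refine tendsto_finsetSum _ fun j hj => ?_
  apply ENNReal.tendsto_pow_atTop_nhds_zero_of_lt_one
  exact bhatt_lt_one (hne i) (hne j) hN₀ fun h => (Finset.ne_of_mem_erase hj) (hdist h).symm
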